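/- If G is a connected graph all of whose atoms (the induced subgraphs without clique cutsets arising from a clique cutset decomposition) are (pan, even hole)-free, then G is a clique, or G contains a clique cutset, or for every maximal buoy B of G, either B contains all vertices of G or G is the join of B and a nonempty clique. -/

import Mathlib

def IsHole {V : Type*} (G : SimpleGraph V) (n : ℕ) (f : ZMod n → V) : Prop :=
  4 ≤ n ∧ Function.Injective f ∧
    ∀ i j : ZMod n, G.Adj (f i) (f j) ↔ (j = i + 1 ∨ i = j + 1)

def HasInducedPan {V : Type*} (G : SimpleGraph V) : Prop :=
  ∃ (n : ℕ) (f : ZMod n → V) (x : V),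
    IsHole G n f ∧ x ∉ Set.range f ∧ ∃! i : ZMod n, G.Adj x (f i)

def HasEvenHole {V : Type*} (G : SimpleGraph V) : Prop :=
  ∃ (n : ℕ) (f : ZMod n → V), IsHole G n f ∧ Even n

def IsBuoy {V : Type*} (G : SimpleGraph V) (ℓ : ℕ) (B : ZMod ℓ → Set V) : Prop :=
  5 ≤ ℓ ∧
  (∀ i, (B i).Nonempty) ∧
  (∀ i, G.IsClique (B i)) ∧
  (Pairwise fun i j => Disjoint (B i) (B j)) ∧
  (∀ i, ∀ v ∈ B i, ∃ u ∈ B (i + 1), G.Adj v u) ∧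
  (∀ i, ∀ v ∈ B i, ∃ u ∈ B (i - 1), G.Adj v u) ∧
  (∀ i j : ZMod ℓ, j ≠ i → j ≠ i + 1 → j ≠ i - 1 →
    ∀ v ∈ B i, ∀ u ∈ B j, ¬ G.Adj v u)

/-- S is a clique cutset of H: it induces a clique and its removal
disconnects two vertices that were connected in H. -/
def IsCliqueCutset {W : Type*} (H : SimpleGraph W) (S : Set W) : Prop :=
  H.IsClique S ∧ ∃ u v : ↥(Sᶜ), H.Reachable ↑u ↑v ∧ ¬ (H.induce Sᶜ).Reachable u v

/-- A induces an atom of G: a connected induced subgraph without a clique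
cutset. -/
def IsGraphAtom {W : Type*} (G : SimpleGraph W) (A : Set W) : Prop :=
  (G.induce A).Connected ∧ ∀ S : Set ↥A, ¬ IsCliqueCutset (G.induce A) S

/-- X is the vertex set of a buoy of G. -/
def IsBuoySet {W : Type*} (G : SimpleGraph W) (X : Set W) : Prop :=
  ∃ (ℓ : ℕ) (B : ZMod ℓ → Set W), IsBuoy G ℓ B ∧ X = ⋃ j, B j

/-- X is the vertex set of a maximal buoy of G. -/
def IsMaximalBuoy {W : Type*} (G : SimpleGraph W) (X : Set W) : Prop :=
  IsBuoySet G X ∧ ∀ Y : Set W, IsBuoySet G Y → X ⊆ Y → Y = X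

section helpers

theorem zcast {n a b : ℕ} (ha : a < n) (hb : b < n) : ((a : ZMod n) = (b : ZMod n)) ↔ a = b := by
  rw [ZMod.natCast_eq_natCast_iff', Nat.mod_eq_of_lt ha, Nat.mod_eq_of_lt hb]

theorem zsucc {n : ℕ} (hn : 2 ≤ n) (i j : ZMod n) :
    j = i + 1 ↔ (j.val = i.val + 1 ∨ (i.val + 1 = n ∧ j.val = 0)) := by
  haveI : NeZero n := ⟨by omega⟩
  have hi := ZMod.val_lt i
  have hj := ZMod.val_lt j
  have e : i + 1 = ((i.val + 1 : ℕ) : ZMod n) := by simp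
  have e2 : j = ((j.val : ℕ) : ZMod n) := by simp
  rw [e]
  by_cases h : i.val + 1 = n
  · rw [h, ZMod.natCast_self]
    rw [← ZMod.val_eq_zero]
    omega
  · conv_lhs => rw [e2]
    rw [zcast hj (by omega)]
    omega

theorem hole_of_nat {V : Type*} {G : SimpleGraph V} (n : ℕ) (c : ℕ → V) (hn : 4 ≤ n)
    (h : ∀ a b, a < b → b < n → c a ≠ c b ∧ (G.Adj (c a) (c b) ↔ (b = a + 1 ∨ (a = 0 ∧ b + 1 = n)))) :
    IsHole G n (fun i => c i.val) := by
  haveI : NeZero n := ⟨by omega⟩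
  refine ⟨hn, ?_, ?_⟩
  · intro i j hij
    apply ZMod.val_injective
    by_contra hne
    rcases lt_or_gt_of_ne hne with h1 | h1
    · exact (h _ _ h1 (ZMod.val_lt j)).1 hij
    · exact (h _ _ h1 (ZMod.val_lt i)).1 hij.symm
  · intro i j
    have hi := ZMod.val_lt i
    have hj := ZMod.val_lt j
    rw [zsucc (by omega), zsucc (by omega)]
    rcases lt_trichotomy i.val j.val with h1 | h1 | h1
    · simp only [(h _ _ h1 hj).2]; omega
    · simp only [h1]
      constructor
      · intro h2; exact absurd h2 (G.loopless.irrefl _)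
      · intro h2; omega
    · simp only [G.adj_comm (c i.val), (h _ _ h1 hi).2]; omega

theorem arc_of_hole {V : Type*} {G : SimpleGraph V} {n : ℕ} {f : ZMod n → V} (hf : IsHole G n f)
    (i : ZMod n) (a b : ℕ) (hab : a < b) (hb : b < n) :
    f (i + a) ≠ f (i + b) ∧ (G.Adj (f (i + a)) (f (i + b)) ↔ (b = a + 1 ∨ (a = 0 ∧ b + 1 = n))) := by
  obtain ⟨hn, hinj, hadj⟩ := hf
  constructor
  · intro h
    have := add_left_cancel (hinj h)
    rw [zcast (by omega) hb] at this
    omega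
  · rw [hadj]
    have e1 : i + (b : ZMod n) = i + a + 1 ↔ b = a + 1 := by
      have : i + (a : ZMod n) + 1 = i + ((a + 1 : ℕ) : ZMod n) := by push_cast; ring
      rw [this, add_right_inj, zcast hb (by omega)]
    have e2 : i + (a : ZMod n) = i + b + 1 ↔ (a = 0 ∧ b + 1 = n) := by
      have : i + (b : ZMod n) + 1 = i + ((b + 1 : ℕ) : ZMod n) := by push_cast; ring
      rw [this, add_right_inj]
      by_cases h : b + 1 = n
      · have h0 : ((b + 1 : ℕ) : ZMod n) = ((0 : ℕ) : ZMod n) := by rw [h]; simp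
        rw [h0, zcast (by omega) (by omega)]
        omega
      · rw [zcast (by omega) (by omega)]; omega
    rw [e1, e2]

/-- vertices 0..m of p form an induced path -/
def IndPath {V : Type*} (G : SimpleGraph V) (m : ℕ) (p : ℕ → V) : Prop :=
  ∀ a b, a < b → b ≤ m → p a ≠ p b ∧ (G.Adj (p a) (p b) ↔ b = a + 1)

theorem IndPath.rev {V : Type*} {G : SimpleGraph V} {m : ℕ} {p : ℕ → V} (h : IndPath G m p) :
    IndPath G m (fun t => p (m - t)) := by
  intro a b hab hb
  have := h (m - b) (m - a) (by omega) (by omega)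
  refine ⟨this.1.symm, ?_⟩
  simp only [G.adj_comm (p (m - a)), this.2]
  omega

theorem arc_path {V : Type*} {G : SimpleGraph V} {n : ℕ} {f : ZMod n → V} (hf : IsHole G n f)
    (i : ZMod n) (m : ℕ) (hm : m + 2 ≤ n) : IndPath G m (fun t => f (i + t)) := by
  intro a b hab hb
  have := arc_of_hole hf i a b hab (by omega)
  refine ⟨this.1, this.2.trans ?_⟩
  omega

theorem glue {V : Type*} {G : SimpleGraph V} {m k : ℕ} {p q : ℕ → V} (hmk : 4 ≤ m + k + 2)
    (hp : IndPath G m p) (hq : IndPath G k q)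
    (hpq : ∀ a b, a ≤ m → b ≤ k → p a ≠ q b ∧
      (G.Adj (p a) (q b) ↔ ((a = m ∧ b = 0) ∨ (a = 0 ∧ b = k)))) :
    ∃ f : ZMod (m + k + 2) → V, IsHole G (m + k + 2) f ∧
      ∀ v, v ∈ Set.range f ↔ ((∃ a, a ≤ m ∧ v = p a) ∨ ∃ b, b ≤ k ∧ v = q b) := by
  let c : ℕ → V := fun t => if t ≤ m then p t else q (t - m - 1)
  refine ⟨_, hole_of_nat (m + k + 2) c hmk ?_, ?_⟩
  · intro a b hab hb
    by_cases h1 : b ≤ m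
    · have h2 : a ≤ m := by omega
      simp only [c, h1, h2, if_true]
      refine ⟨(hp a b hab h1).1, (hp a b hab h1).2.trans ?_⟩
      omega
    · by_cases h2 : a ≤ m
      · simp only [c, h1, h2, if_true, if_false]
        have := hpq a (b - m - 1) h2 (by omega)
        refine ⟨this.1, this.2.trans ?_⟩
        omega
      · simp only [c, h1, h2, if_false]
        have := hq (a - m - 1) (b - m - 1) (by omega) (by omega)
        refine ⟨this.1, this.2.trans ?_⟩
        omega
  · intro v
    constructor
    · rintro ⟨i, rfl⟩
      have := ZMod.val_lt i
      by_cases h : i.val ≤ m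
      · left; exact ⟨i.val, h, by simp [c, h]⟩
      · right; exact ⟨i.val - m - 1, by omega, by simp [c, h]⟩
    · rintro (⟨a, ha, rfl⟩ | ⟨b, hb, rfl⟩)
      · refine ⟨(a : ZMod (m + k + 2)), ?_⟩
        simp only [ZMod.val_natCast, c]
        rw [Nat.mod_eq_of_lt (by omega)]
        simp [ha]
      · refine ⟨((b + m + 1 : ℕ) : ZMod (m + k + 2)), ?_⟩
        simp only [ZMod.val_natCast, c]
        rw [Nat.mod_eq_of_lt (by omega), if_neg (by omega)]
        congr 1
        omega

theorem glue_even {V : Type*} {G : SimpleGraph V} (hE : ¬ HasEvenHole G) {m k : ℕ} {p q : ℕ → V}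
    (hmk : 4 ≤ m + k + 2)
    (hp : IndPath G m p) (hq : IndPath G k q)
    (hpq : ∀ a b, a ≤ m → b ≤ k → p a ≠ q b ∧
      (G.Adj (p a) (q b) ↔ ((a = m ∧ b = 0) ∨ (a = 0 ∧ b = k)))) : ¬ Even (m + k) := by
  intro he
  obtain ⟨f, hf, -⟩ := glue hmk hp hq hpq
  exact hE ⟨_, f, hf, by simpa [Nat.even_add] using he⟩

theorem pan_of {V : Type*} {G : SimpleGraph V} (hP : ¬ HasInducedPan G) {n : ℕ} {f : ZMod n → V}
    (hf : IsHole G n f) (y w : V) (hy : y ∉ Set.range f) (hw : w ∈ Set.range f) (hyw : G.Adj y w)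
    (h : ∀ v ∈ Set.range f, G.Adj y v → v = w) : False := by
  obtain ⟨i, rfl⟩ := hw
  exact hP ⟨n, f, y, hf, hy, i, hyw, fun j hj => hf.2.1 (h _ ⟨j, rfl⟩ hj)⟩

theorem noC4 {V : Type*} {G : SimpleGraph V} (hE : ¬ HasEvenHole G) (a b c d : V)
    (hab : G.Adj a b) (hbc : G.Adj b c) (hcd : G.Adj c d) (hda : G.Adj d a)
    (hac : a ≠ c) (hbd : b ≠ d) (h1 : ¬ G.Adj a c) (h2 : ¬ G.Adj b d) : False := by
  have key := hole_of_nat (G := G) 4 (fun t => if t = 0 then a else if t = 1 then b else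
    if t = 2 then c else d) le_rfl ?_
  · exact hE ⟨4, _, key, by decide⟩
  · intro x y hxy hy
    have := hab.ne; have := hbc.ne; have := hcd.ne; have := hda.ne
    have := hab.symm; have := hbc.symm; have := hcd.symm; have := hda.symm
    interval_cases y <;> interval_cases x <;> simp_all [eq_comm]

end helpers

theorem hole_nbrs {V : Type*} {G : SimpleGraph V} (hE : ¬ HasEvenHole G) (hP : ¬ HasInducedPan G)
    {n : ℕ} {f : ZMod n → V} (hf : IsHole G n f) (x : V) (hx : x ∉ Set.range f) :
    (∀ i, ¬ G.Adj x (f i)) ∨ (∀ i, G.Adj x (f i)) ∨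
    ∃ i, G.Adj x (f i) ∧ G.Adj x (f (i + 1)) ∧
      ∀ j, G.Adj x (f j) → (j = i - 1 ∨ j = i ∨ j = i + 1) := by
  have hn : 4 ≤ n := hf.1
  have : NeZero n := ⟨by omega⟩
  have hodd : ¬ Even n := fun h => hE ⟨n, f, hf, h⟩
  by_cases h0 : ∀ i, ¬ G.Adj x (f i)
  · exact Or.inl h0
  by_cases h1 : ∀ i, G.Adj x (f i)
  · exact Or.inr (Or.inl h1)
  right; right
  have rep : ∀ j k : ZMod n, ∃ t : ℕ, t < n ∧ k = j + t := by
    intro j k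
    refine ⟨(k - j).val, ZMod.val_lt _, by simp⟩
  obtain ⟨j, hj, hj1⟩ : ∃ j, G.Adj x (f j) ∧ ¬ G.Adj x (f (j + 1)) := by
    by_contra hcon
    push Not at hcon h0
    obtain ⟨i, hi⟩ := h0
    apply h1
    intro k
    obtain ⟨t, -, rfl⟩ := rep i k
    clear h1
    induction t with
    | zero => simpa using hi
    | succ t ih =>
      have := hcon _ ih
      push_cast
      rwa [← add_assoc]
  have hc := arc_of_hole hf j
  set c : ℕ → V := fun t => f (j + t) with hcdef
  have hc' : ∀ a b, a < b → b < n → c a ≠ c b ∧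
      (G.Adj (c a) (c b) ↔ (b = a + 1 ∨ (a = 0 ∧ b + 1 = n))) := hc
  have A0 : G.Adj x (c 0) := by simpa [hcdef] using hj
  have A1 : ¬ G.Adj x (c 1) := by simpa [hcdef] using hj1
  have hxc : ∀ t, x ≠ c t := fun t h => hx ⟨_, h.symm⟩
  have cast1 : ((n - 1 : ℕ) : ZMod n) = -1 := by
    rw [Nat.cast_sub (by omega)]; simp
  clear_value c
  by_cases hex : ∃ t, 2 ≤ t ∧ t < n ∧ G.Adj x (c t)
  · classical
    let d := Nat.find hex
    obtain ⟨hd2, hdn, hdA⟩ : 2 ≤ d ∧ d < n ∧ G.Adj x (c d) := Nat.find_spec hex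
    have hmin : ∀ t, 0 < t → t < d → ¬ G.Adj x (c t) := by
      intro t ht0 ht hA
      by_cases h : t = 1
      · subst h; exact A1 hA
      · exact Nat.find_min hex ht ⟨by omega, by omega, hA⟩
    clear_value d
    by_cases hdn1 : d + 1 = n
    · refine ⟨j - 1, ?_, ?_, ?_⟩
      · have : c d = f (j - 1) := by
          simp only [hcdef]
          have : d = n - 1 := by omega
          rw [this, cast1, sub_eq_add_neg]
        rwa [← this]
      · simpa using hj
      · intro k hk
        obtain ⟨t, ht, rfl⟩ := rep j k
        have hk' : G.Adj x (c t) := by simpa [hcdef] using hk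
        by_cases ht0 : t = 0
        · subst ht0; right; right; simp
        · have : t = n - 1 := by
            by_contra h
            exact hmin t (by omega) (by omega) hk'
          right; left
          rw [this, cast1, sub_eq_add_neg]
    · have hp1 : IndPath G d c := by
        intro a b hab hb
        refine ⟨(hc' a b hab (by omega)).1, (hc' a b hab (by omega)).2.trans ?_⟩
        omega
      have hq1 : IndPath G 0 (fun _ => x) := by
        intro a b hab hb; omega
      have hpq1 : ∀ a b, a ≤ d → b ≤ 0 → c a ≠ (fun _ : ℕ => x) b ∧
          (G.Adj (c a) ((fun _ : ℕ => x) b) ↔ ((a = d ∧ b = 0) ∨ (a = 0 ∧ b = 0))) := by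
        intro a b ha hb
        refine ⟨(hxc a).symm, ?_⟩
        have hb0 : b = 0 := by omega
        constructor
        · intro h
          by_contra hne
          exact hmin a (by omega) (by omega) h.symm
        · rintro (⟨rfl, -⟩ | ⟨rfl, -⟩)
          · exact hdA.symm
          · exact A0.symm
      have hdodd := glue_even hE (by omega) hp1 hq1 hpq1
      obtain ⟨g, hg, hgr⟩ := glue (by omega) hp1 hq1 hpq1
      have hpan : ∀ t w, d < t → t < n → ((∃ a, a ≤ d ∧ w = c a) ∨ w = x) → G.Adj (c t) w →
          (∀ a, a ≤ d → G.Adj (c t) (c a) → c a = w) → (G.Adj (c t) x → x = w) → False := by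
        intro t w hdt htn hw hadj hca hcx
        refine pan_of hP hg (c t) w ?_ ?_ hadj ?_
        · rw [hgr]
          rintro (⟨a, ha, h⟩ | ⟨b, hb, h⟩)
          · exact (hc' a t (by omega) htn).1 h.symm
          · exact hxc t h.symm
        · rw [hgr]
          rcases hw with hw | hw
          · exact Or.inl hw
          · exact Or.inr ⟨0, le_rfl, hw⟩
        · intro v hv hav
          rw [hgr] at hv
          rcases hv with ⟨a, ha, rfl⟩ | ⟨b, hb, rfl⟩
          · exact hca a ha hav
          · exact hcx hav
      have hadjt : ∀ t a, d < t → t < n → a ≤ d → G.Adj (c t) (c a) →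
          (t = a + 1 ∨ (a = 0 ∧ t + 1 = n)) := by
        intro t a h1 h2 h3 h4
        exact (hc' a t (by omega) h2).2.1 h4.symm
      by_cases hdn2 : d + 2 = n
      · have An1 : G.Adj x (c (d + 1)) := by
          by_contra hna
          refine noC4 hE x (c d) (c (d + 1)) (c 0) hdA ?_ ?_ A0.symm (hxc _) ?_ hna ?_
          · exact (hc' d (d + 1) (by omega) (by omega)).2.2 (Or.inl rfl)
          · exact ((hc' 0 (d + 1) (by omega) (by omega)).2.2 (Or.inr ⟨rfl, by omega⟩)).symm
          · exact (hc' 0 d (by omega) (by omega)).1.symm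
          · intro h
            have := (hc' 0 d (by omega) (by omega)).2.1 h.symm
            omega
        refine ⟨j - 1, ?_, ?_, ?_⟩
        · have : c (d + 1) = f (j - 1) := by
            simp only [hcdef]
            have : d + 1 = n - 1 := by omega
            rw [this, cast1, sub_eq_add_neg]
          rwa [← this]
        · simpa using hj
        · intro k hk
          obtain ⟨t, ht, rfl⟩ := rep j k
          have hk' : G.Adj x (c t) := by simpa [hcdef] using hk
          by_cases ht0 : t = 0
          · subst ht0; right; right; simp
          · by_cases htd : t < d
            · exact absurd hk' (hmin t (by omega) htd)
            · by_cases ht1 : t = n - 1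
              · right; left
                rw [ht1, cast1, sub_eq_add_neg]
              · left
                have : t = n - 2 := by omega
                rw [this, Nat.cast_sub (by omega)]
                simp
                ring
      · exfalso
        have P2 : G.Adj x (c (d + 1)) := by
          by_contra hna
          refine hpan (d + 1) (c d) (by omega) (by omega) (Or.inl ⟨d, le_rfl, rfl⟩) ?_ ?_ ?_
          · exact ((hc' d (d + 1) (by omega) (by omega)).2.2 (Or.inl rfl)).symm
          · intro a ha h
            have := hadjt _ a (by omega) (by omega) ha h
            have : a = d := by omega
            rw [this]
          · intro h; exact absurd h.symm hna
        have P3 : G.Adj x (c (n - 1)) := by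
          by_contra hna
          refine hpan (n - 1) (c 0) (by omega) (by omega) (Or.inl ⟨0, by omega, rfl⟩) ?_ ?_ ?_
          · exact ((hc' 0 (n - 1) (by omega) (by omega)).2.2 (Or.inr ⟨rfl, by omega⟩)).symm
          · intro a ha h
            have := hadjt _ a (by omega) (by omega) ha h
            have : a = 0 := by omega
            rw [this]
          · intro h; exact absurd h.symm hna
        have P1 : ∀ t, d + 1 < t → t + 1 < n → ¬ G.Adj x (c t) := by
          intro t ht1 ht2 hA
          refine hpan t x (by omega) (by omega) (Or.inr rfl) hA.symm ?_ (fun _ => rfl)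
          intro a ha h
          have := hadjt _ a (by omega) (by omega) ha h
          omega
        refine glue_even hE (m := n - d - 2) (k := 0) (p := fun t => c (d + 1 + t))
          (q := fun _ => x) ?_ ?_ hq1 ?_ ?_
        · rcases Nat.even_or_odd' d with ⟨r, hr | hr⟩
          · exact absurd ⟨r, by omega⟩ hdodd
          · rcases Nat.even_or_odd' n with ⟨s, hs | hs⟩
            · exact absurd ⟨s, by omega⟩ hodd
            · omega
        · intro a b hab hb
          have := hc' (d + 1 + a) (d + 1 + b) (by omega) (by omega)
          refine ⟨this.1, this.2.trans ?_⟩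
          omega
        · intro a b ha hb
          refine ⟨(hxc _).symm, ?_⟩
          constructor
          · intro h
            by_contra hne
            exact P1 (d + 1 + a) (by omega) (by omega) h.symm
          · rintro (⟨rfl, -⟩ | ⟨rfl, -⟩)
            · have : d + 1 + (n - d - 2) = n - 1 := by omega
              simp only [this]
              exact P3.symm
            · exact P2.symm
        · rcases Nat.even_or_odd' d with ⟨r, hr | hr⟩
          · exact absurd ⟨r, by omega⟩ hdodd
          · rcases Nat.even_or_odd' n with ⟨s, hs | hs⟩
            · exact absurd ⟨s, by omega⟩ hodd
            · exact ⟨s - r - 1, by omega⟩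
  · exfalso
    push Not at hex
    refine pan_of hP hf x (f j) hx ⟨j, rfl⟩ hj ?_
    rintro v ⟨k, rfl⟩ hk
    obtain ⟨t, ht, rfl⟩ := rep j k
    have hk' : G.Adj x (c t) := by simpa [hcdef] using hk
    by_cases ht0 : t = 0
    · subst ht0; simp
    · by_cases ht1 : t = 1
      · subst ht1; exact absurd hk' A1
      · exact absurd hk' (hex t (by omega) ht)

theorem znz {n : ℕ} (hn : 5 ≤ n) : (1 : ZMod n) ≠ 0 ∧ (2 : ZMod n) ≠ 0 ∧ (3 : ZMod n) ≠ 0 ∧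
    (4 : ZMod n) ≠ 0 := by
  have key : ∀ a : ℕ, 0 < a → a < 5 → ((a : ℕ) : ZMod n) ≠ 0 := by
    intro a h0 h5 h
    have h' : ((a : ℕ) : ZMod n) = ((0 : ℕ) : ZMod n) := by simpa using h
    rw [zcast (by omega) (by omega)] at h'
    omega
  refine ⟨?_, ?_, ?_, ?_⟩
  · simpa using key 1 (by omega) (by omega)
  · simpa using key 2 (by omega) (by omega)
  · simpa using key 3 (by omega) (by omega)
  · simpa using key 4 (by omega) (by omega)

def IsTransv {V : Type*} (G : SimpleGraph V) {n : ℕ} (B : ZMod n → Set V) (h : ZMod n → V) : Prop :=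
  ∀ i, h i ∈ B i ∧ G.Adj (h i) (h (i + 1))

theorem IsBuoy.bag_eq {V : Type*} {G : SimpleGraph V} {n : ℕ} {B : ZMod n → Set V}
    (hB : IsBuoy G n B) {i j : ZMod n} {v : V} (hi : v ∈ B i) (hj : v ∈ B j) : i = j := by
  by_contra hne
  exact Set.disjoint_left.1 (hB.2.2.2.1 hne) hi hj

theorem IsBuoy.adj_idx {V : Type*} {G : SimpleGraph V} {n : ℕ} {B : ZMod n → Set V}
    (hB : IsBuoy G n B) {i j : ZMod n} {u v : V} (hi : u ∈ B i) (hj : v ∈ B j) (h : G.Adj u v) :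
    j = i ∨ j = i + 1 ∨ j = i - 1 := by
  by_contra hne
  push Not at hne
  exact hB.2.2.2.2.2.2 i j hne.1 hne.2.1 hne.2.2 u hi v hj h

theorem IsBuoy.reflect {V : Type*} {G : SimpleGraph V} {n : ℕ} {B : ZMod n → Set V}
    (hB : IsBuoy G n B) : IsBuoy G n (fun i => B (-i)) := by
  obtain ⟨h5, hne, hcl, hdj, hn, hp, hnon⟩ := hB
  refine ⟨h5, fun i => hne _, fun i => hcl _, ?_, ?_, ?_, ?_⟩
  · intro i j hij
    exact hdj (fun h => hij (neg_injective h))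
  · intro i v hv
    obtain ⟨u, hu, ha⟩ := hp _ v hv
    refine ⟨u, ?_, ha⟩
    have : -(i + 1) = -i - 1 := by ring
    simpa only [this] using hu
  · intro i v hv
    obtain ⟨u, hu, ha⟩ := hn _ v hv
    refine ⟨u, ?_, ha⟩
    have : -(i - 1) = -i + 1 := by ring
    simpa only [this] using hu
  · intro i j h1 h2 h3 v hv u hu
    refine hnon _ _ ?_ ?_ ?_ v hv u hu
    · intro h; exact h1 (neg_injective h)
    · intro h; apply h3; linear_combination -h
    · intro h; apply h2; linear_combination -h

theorem IsTransv.reflect {V : Type*} {G : SimpleGraph V} {n : ℕ} {B : ZMod n → Set V}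
    {h : ZMod n → V} (hT : IsTransv G B h) : IsTransv G (fun i => B (-i)) (fun i => h (-i)) := by
  intro i
  refine ⟨(hT _).1, ?_⟩
  have := (hT (-(i + 1))).2
  have e : -(i + 1) + 1 = -i := by ring
  rw [e] at this
  exact this.symm

theorem IsTransv.hole {V : Type*} {G : SimpleGraph V} {n : ℕ} {B : ZMod n → Set V}
    (hB : IsBuoy G n B) {h : ZMod n → V} (hT : IsTransv G B h) : IsHole G n h := by
  refine ⟨by have := hB.1; omega, ?_, ?_⟩
  · intro i j hij
    exact hB.bag_eq (hT i).1 (hij ▸ (hT j).1)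
  · intro i j
    constructor
    · intro ha
      rcases hB.adj_idx (hT i).1 (hT j).1 ha with h1 | h1 | h1
      · subst h1; exact absurd ha (G.loopless.irrefl _)
      · exact Or.inl h1
      · right; rw [h1]; ring
    · rintro (rfl | rfl)
      · exact (hT i).2
      · exact (hT j).2.symm

theorem exists_trans {V : Type*} [Fintype V] {G : SimpleGraph V} (hE : ¬ HasEvenHole G) {n : ℕ}
    {B : ZMod n → Set V} (hB : IsBuoy G n B) : ∃ h, IsTransv G B h := by
  classical
  have hz := znz hB.1
  have key : ∀ i, ∃ v ∈ B i, ∀ c ∈ B (i + 1), G.Adj v c := by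
    intro i
    obtain ⟨v, hv, hmax⟩ := Set.exists_max_image (B i)
      (fun v => (Finset.univ.filter (fun c => c ∈ B (i + 1) ∧ G.Adj v c)).card)
      (Set.toFinite _) (hB.2.1 i)
    refine ⟨v, hv, ?_⟩
    intro c hc
    by_contra hvc
    obtain ⟨v', hv', hcv'⟩ := hB.2.2.2.2.2.1 (i + 1) c hc
    rw [add_sub_cancel_right] at hv'
    have hne : v ≠ v' := by rintro rfl; exact hvc hcv'.symm
    have hvv' : G.Adj v v' := hB.2.2.1 i hv hv' hne
    obtain ⟨c', hc', hvc', hn'⟩ : ∃ c', c' ∈ B (i + 1) ∧ G.Adj v c' ∧ ¬ G.Adj v' c' := by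
      by_contra hcon
      push Not at hcon
      have hlt : (Finset.univ.filter (fun c => c ∈ B (i + 1) ∧ G.Adj v c)).card <
          (Finset.univ.filter (fun c => c ∈ B (i + 1) ∧ G.Adj v' c)).card := by
        apply Finset.card_lt_card
        rw [Finset.ssubset_iff_of_subset]
        · exact ⟨c, by simp [hc, hcv'.symm], by simp [hvc]⟩
        · intro a ha
          simp only [Finset.mem_filter, Finset.mem_univ, true_and] at ha ⊢
          exact ⟨ha.1, hcon a ha.1 ha.2⟩
      have := hmax v' hv'
      omega
    have hcc : c ≠ c' := by rintro rfl; exact hvc hvc'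
    refine noC4 hE v v' c c' hvv' hcv'.symm (hB.2.2.1 _ hc hc' hcc) hvc'.symm ?_ ?_ hvc hn'
    · rintro rfl
      exact hz.1 (left_eq_add.1 (hB.bag_eq hv hc))
    · rintro rfl
      exact hz.1 (left_eq_add.1 (hB.bag_eq hv' hc'))
  choose h hh hh2 using key
  exact ⟨h, fun i => ⟨hh i, hh2 i _ (hh (i + 1))⟩⟩

theorem even_ext {V : Type*} {G : SimpleGraph V} (hE : ¬ HasEvenHole G) {n : ℕ}
    {h : ZMod n → V} (hh : IsHole G n h) (i : ZMod n) (y z : V) (hyz : G.Adj y z)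
    (hy : G.Adj y (h i)) (hz : G.Adj z (h (i + 2)))
    (hy' : ∀ t, G.Adj y (h t) → (t = i ∨ t = i + 1))
    (hz' : ∀ t, G.Adj z (h t) → (t = i + 2 ∨ t = i + 1))
    (hyn : ∀ t, y ≠ h t) (hzn : ∀ t, z ≠ h t) : False := by
  have hn := hh.1
  have hodd : ¬ Even n := fun hev => hE ⟨n, h, hh, hev⟩
  have e1 : ∀ a : ℕ, a ≤ n - 2 → (i + 2 + (a : ZMod n) = i ↔ a = n - 2) := by
    intro a ha
    have : i = i + 2 + ((n - 2 : ℕ) : ZMod n) := by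
      rw [Nat.cast_sub (by omega)]; simp
    constructor
    · intro h1
      have h2 : (a : ZMod n) = ((n - 2 : ℕ) : ZMod n) := by linear_combination h1 + this
      rwa [zcast (by omega) (by omega)] at h2
    · rintro rfl; exact this.symm
  have e2 : ∀ a : ℕ, a ≤ n - 2 → (i + 2 + (a : ZMod n) ≠ i + 1) := by
    intro a ha h1
    have h2 : ((a + 1 : ℕ) : ZMod n) = ((0 : ℕ) : ZMod n) := by push_cast; linear_combination h1
    rw [zcast (by omega) (by omega)] at h2
    omega
  have e3 : ∀ a : ℕ, a ≤ n - 2 → (i + 2 + (a : ZMod n) = i + 2 ↔ a = 0) := by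
    intro a ha
    constructor
    · intro h1
      have h2 : ((a : ℕ) : ZMod n) = ((0 : ℕ) : ZMod n) := by push_cast; linear_combination h1
      rwa [zcast (by omega) (by omega)] at h2
    · rintro rfl; simp
  refine glue_even hE (m := n - 2) (k := 1) (p := fun t => h (i + 2 + t))
    (q := fun t => if t = 0 then y else z) (by omega) (arc_path hh _ _ (by omega)) ?_ ?_ ?_
  · intro a b hab hb
    have ha : a = 0 := by omega
    have hb : b = 1 := by omega
    subst ha hb
    simp [hyz, hyz.ne]
  · intro a b ha hb
    have hb : b = 0 ∨ b = 1 := by omega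
    rcases hb with rfl | rfl
    · change h _ ≠ y ∧ (G.Adj (h _) y ↔ _)
      refine ⟨(hyn _).symm, ?_⟩
      constructor
      · intro h1
        rcases hy' _ h1.symm with h2 | h2
        · rw [e1 a ha] at h2; omega
        · exact absurd h2 (e2 a ha)
      · intro h1
        have : a = n - 2 := by omega
        rw [← e1 a ha] at this
        rw [this]; exact hy.symm
    · change h _ ≠ z ∧ (G.Adj (h _) z ↔ _)
      refine ⟨(hzn _).symm, ?_⟩
      constructor
      · intro h1
        rcases hz' _ h1.symm with h2 | h2
        · rw [e3 a ha] at h2; omega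
        · exact absurd h2 (e2 a ha)
      · intro h1
        have : a = 0 := by omega
        rw [← e3 a ha] at this
        rw [this]; exact hz.symm
  · rcases Nat.even_or_odd' n with ⟨s, hs | hs⟩
    · exact absurd ⟨s, by omega⟩ hodd
    · exact ⟨s, by omega⟩

theorem bag_adj {V : Type*} {G : SimpleGraph V} (hP : ¬ HasInducedPan G)
    {n : ℕ} {B : ZMod n → Set V} (hB : IsBuoy G n B) {h : ZMod n → V} (hT : IsTransv G B h)
    (j : ZMod n) (b : V) (hb : b ∈ B j) : G.Adj b (h (j - 1)) ∨ G.Adj b (h (j + 1)) := by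
  by_cases hbj : b = h j
  · right; rw [hbj]; exact (hT j).2
  · by_contra hcon
    push Not at hcon
    refine pan_of hP (hT.hole hB) b (h j) ?_ ⟨j, rfl⟩ (hB.2.2.1 j hb (hT j).1 hbj) ?_
    · rintro ⟨k, rfl⟩
      have := hB.bag_eq (hT k).1 hb
      exact hbj (by rw [this])
    · rintro v ⟨k, rfl⟩ hk
      rcases hB.adj_idx hb (hT k).1 hk with rfl | rfl | rfl
      · rfl
      · exact absurd hk hcon.2
      · exact absurd hk hcon.1

theorem swap_fwd {V : Type*} {G : SimpleGraph V} (hE : ¬ HasEvenHole G)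
    {n : ℕ} {B : ZMod n → Set V} (hB : IsBuoy G n B) {h : ZMod n → V} (hT : IsTransv G B h)
    (j : ZMod n) (b : V) (hb : b ∈ B j) (h1 : G.Adj b (h (j - 1))) (h2 : ¬ G.Adj b (h (j + 1))) :
    ∃ z ∈ B (j + 1), G.Adj z (h j) ∧ G.Adj b z ∧ G.Adj z (h (j + 2)) := by
  have hz := znz hB.1
  have hbj : b ≠ h j := by rintro rfl; exact h2 (hT j).2
  obtain ⟨z, hzB, hbz⟩ := hB.2.2.2.2.1 j b hb
  have hzn : z ≠ h (j + 1) := by rintro rfl; exact h2 hbz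
  have hzj : G.Adj z (h j) := by
    by_contra hna
    refine noC4 hE b (h j) (h (j + 1)) z (hB.2.2.1 j hb (hT j).1 hbj) (hT j).2
      (hB.2.2.1 _ (hT _).1 hzB hzn.symm) hbz.symm ?_ ?_ h2 (fun h => hna h.symm)
    · rintro rfl
      exact hz.1 (left_eq_add.1 (hB.bag_eq hb (hT _).1))
    · intro h'
      exact hz.1 (left_eq_add.1 (hB.bag_eq (hT j).1 (h' ▸ hzB)))
  refine ⟨z, hzB, hzj, hbz, ?_⟩
  by_contra hna
  have e : j - 1 + 2 = j + 1 := by ring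
  refine even_ext hE (hT.hole hB) (j - 1) b z hbz h1 ?_ ?_ ?_ ?_ ?_
  · rw [e]; exact hB.2.2.1 _ hzB (hT _).1 hzn
  · intro t ht
    rcases hB.adj_idx hb (hT t).1 ht with rfl | rfl | rfl
    · right; ring
    · exact absurd ht h2
    · left; rfl
  · intro t ht
    rcases hB.adj_idx hzB (hT t).1 ht with rfl | rfl | rfl
    · left; ring
    · exfalso; apply hna; convert ht using 2; ring
    · right; ring
  · intro t ht
    have := hB.bag_eq hb (ht ▸ (hT t).1)
    exact hbj (by rw [ht, this])
  · intro t ht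
    have := hB.bag_eq hzB (ht ▸ (hT t).1)
    exact hzn (by rw [ht, this])

theorem swap_bwd {V : Type*} {G : SimpleGraph V} (hE : ¬ HasEvenHole G)
    {n : ℕ} {B : ZMod n → Set V} (hB : IsBuoy G n B) {h : ZMod n → V} (hT : IsTransv G B h)
    (j : ZMod n) (b : V) (hb : b ∈ B j) (h1 : G.Adj b (h (j + 1))) (h2 : ¬ G.Adj b (h (j - 1))) :
    ∃ z ∈ B (j - 1), G.Adj z (h j) ∧ G.Adj b z ∧ G.Adj z (h (j - 2)) := by
  have e1 : -(-j - 1) = j + 1 := by ring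
  have e2 : -(-j + 1) = j - 1 := by ring
  have e3 : -(-j + 2) = j - 2 := by ring
  obtain ⟨z, hz, ha, hb, hc⟩ := swap_fwd hE hB.reflect hT.reflect (-j) b (by simpa using hb)
    (by simpa only [e1] using h1) (by simpa only [e2] using h2)
  refine ⟨z, ?_, ?_, hb, ?_⟩
  · simpa only [e2] using hz
  · simpa using ha
  · simpa only [e3] using hc

theorem trans_update {V : Type*} {G : SimpleGraph V} [DecidableEq V]
    {n : ℕ} {B : ZMod n → Set V} (hB : IsBuoy G n B) {h : ZMod n → V} (hT : IsTransv G B h)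
    (j : ZMod n) (b : V) (hb : b ∈ B j) (h1 : G.Adj b (h (j - 1))) (h2 : G.Adj b (h (j + 1))) :
    IsTransv G B (Function.update h j b) := by
  have hz := znz hB.1
  intro i
  constructor
  · by_cases hij : i = j
    · subst hij; simpa using hb
    · simpa [hij] using (hT i).1
  · by_cases hij : i = j
    · subst hij
      have : i + 1 ≠ i := fun h => hz.1 (add_eq_left.1 h)
      simpa [this] using h2
    · by_cases hij2 : i + 1 = j
      · subst hij2
        rw [add_sub_cancel_right] at h1
        simpa [hij] using h1.symm
      · simpa [hij, hij2] using (hT i).2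

/-- the main exchange lemma -/
theorem swap {V : Type*} {G : SimpleGraph V} (hE : ¬ HasEvenHole G) (hP : ¬ HasInducedPan G)
    {n : ℕ} {B : ZMod n → Set V} (hB : IsBuoy G n B) {h : ZMod n → V} (hT : IsTransv G B h)
    (j : ZMod n) (b : V) (hb : b ∈ B j) :
    ∃ h1 h2 : ZMod n → V, ∃ e, IsTransv G B h1 ∧ IsTransv G B h2 ∧ (e = j - 1 ∨ e = j + 1) ∧
      (∀ i, i ≠ e → h1 i = h i) ∧ (∀ i, i ≠ j → h2 i = h1 i) ∧ h2 j = b := by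
  classical
  have hz := znz hB.1
  by_cases hm : G.Adj b (h (j - 1))
  · by_cases hp : G.Adj b (h (j + 1))
    · refine ⟨h, Function.update h j b, j - 1, hT, trans_update hB hT j b hb hm hp, Or.inl rfl,
        fun _ _ => rfl, ?_, by simp⟩
      intro i hi; simp [hi]
    · obtain ⟨z, hzB, hzj, hbz, hz2⟩ := swap_fwd hE hB hT j b hb hm hp
      have T1 := trans_update hB hT (j + 1) z hzB (by simpa using hzj)
        (by convert hz2 using 2; ring)
      have n1 : j - 1 ≠ j + 1 := fun h => hz.2.1 (by linear_combination -h)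
      refine ⟨_, _, j + 1, T1, trans_update hB T1 j b hb (by simpa [n1] using hm)
        (by simpa using hbz), Or.inr rfl, ?_, ?_, by simp⟩
      · intro i hi; simp [hi]
      · intro i hi; simp [hi]
  · have hp : G.Adj b (h (j + 1)) := (bag_adj hP hB hT j b hb).resolve_left hm
    obtain ⟨z, hzB, hzj, hbz, hz2⟩ := swap_bwd hE hB hT j b hb hp hm
    have T1 := trans_update hB hT (j - 1) z hzB (by convert hz2 using 2; ring)
      (by simpa using hzj)
    have n1 : j + 1 ≠ j - 1 := fun h => hz.2.1 (by linear_combination h)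
    refine ⟨_, _, j - 1, T1, trans_update hB T1 j b hb (by simpa using hbz)
      (by simpa [n1] using hp), Or.inl rfl, ?_, ?_, by simp⟩
    · intro i hi; simp [hi]
    · intro i hi; simp [hi]

def GoodN {R : Type*} [CommRing R] (o : R) (N : R → Prop) : Prop :=
  (∀ i, ¬ N i) ∨ (∀ i, N i) ∨ ∃ c, N c ∧ N (c + o) ∧ ∀ j, N j → (j = c - o ∨ j = c ∨ j = c + o)

def Arc2 {R : Type*} [CommRing R] (o i : R) (N : R → Prop) : Prop :=
  ∀ j, N j ↔ (j = i ∨ j = i + o)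

def Arc3 {R : Type*} [CommRing R] (o i : R) (N : R → Prop) : Prop :=
  ∀ j, N j ↔ (j = i - o ∨ j = i ∨ j = i + o)

theorem good_cases {R : Type*} [CommRing R] {o : R} {N : R → Prop} (h : GoodN o N) :
    (∀ i, ¬ N i) ∨ (∀ i, N i) ∨ (∃ c, Arc2 o c N) ∨ ∃ c, Arc3 o c N := by
  rcases h with h | h | ⟨c, h1, h2, h3⟩
  · exact Or.inl h
  · exact Or.inr (Or.inl h)
  · right; right
    by_cases hc : N (c - o)
    · right
      refine ⟨c, fun j => ⟨h3 j, ?_⟩⟩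
      rintro (rfl | rfl | rfl) <;> assumption
    · left
      refine ⟨c, fun j => ⟨fun h => ?_, ?_⟩⟩
      · rcases h3 j h with rfl | h | h
        · exact absurd h hc
        · exact Or.inl h
        · exact Or.inr h
      · rintro (rfl | rfl) <;> assumption

theorem step_univ {R : Type*} [CommRing R] {o : R} (hz : o ≠ 0 ∧ o + o ≠ 0 ∧ o + o + o ≠ 0 ∧ o + o + o + o ≠ 0)
    {N N' : R → Prop} {e : R} (hN : ∀ i, N i) (hN' : GoodN o N') (hag : ∀ j, j ≠ e → (N' j ↔ N j)) :
    ∀ i, N' i := by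
  rcases hN' with h | h | ⟨c, h1, h2, h3⟩
  · have a := h (e + o)
    rw [hag _ (by grind)] at a
    exact absurd (hN _) a
  · exact h
  · have h4 := h3 (c + o + o)
    have h5 := h3 (c + o + o + o)
    have h6 := hag (c + o + o)
    have h7 := hag (c + o + o + o)
    have h8 := hN (c + o + o)
    have h9 := hN (c + o + o + o)
    exfalso
    clear h3 hag hN h1 h2
    by_cases he : c + o + o = e
    · have he' : c + o + o + o ≠ e := by grind
      have := (h7 he').2 h9
      rcases h5 this with a | a | a
      · exact hz.2.2.2 (by linear_combination a)
      · exact hz.2.2.1 (by linear_combination a)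
      · exact hz.2.1 (by linear_combination a)
    · have := (h6 he).2 h8
      rcases h4 this with a | a | a
      · exact hz.2.2.1 (by linear_combination a)
      · exact hz.2.1 (by linear_combination a)
      · exact hz.1 (by linear_combination a)

theorem step_empty {R : Type*} [CommRing R] {o : R} (hz : o ≠ 0 ∧ o + o ≠ 0 ∧ o + o + o ≠ 0 ∧ o + o + o + o ≠ 0)
    {N N' : R → Prop} {e : R} (hN : ∀ i, ¬ N i) (hN' : GoodN o N')
    (hag : ∀ j, j ≠ e → (N' j ↔ N j)) : ∀ i, ¬ N' i := by
  rcases hN' with h | h | ⟨c, h1, h2, h3⟩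
  · exact h
  · have a := h (e + o)
    rw [hag _ (by grind)] at a
    exact absurd a (hN _)
  · have h6 := hag c
    have h7 := hag (c + o)
    have h8 := hN c
    have h9 := hN (c + o)
    grind

theorem step_arc2 {R : Type*} [CommRing R] {o : R} (hz : o ≠ 0 ∧ o + o ≠ 0 ∧ o + o + o ≠ 0 ∧ o + o + o + o ≠ 0)
    {N N' : R → Prop} {e i : R} (hN : Arc2 o i N) (hN' : GoodN o N')
    (hag : ∀ j, j ≠ e → (N' j ↔ N j)) :
    Arc2 o i N' ∨ (e = i - o ∧ Arc3 o i N') ∨ (e = i + o + o ∧ Arc3 o (i + o) N') := by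
  have n0 := hN (i - o); have n1 := hN i; have n2 := hN (i + o); have n3 := hN (i + o + o)
  have n4 := hN (i + o + o + o)
  have a0 := hag (i - o); have a1 := hag i; have a2 := hag (i + o); have a3 := hag (i + o + o)
  have a4 := hag (i + o + o + o)
  rcases good_cases hN' with h | h | ⟨c, h⟩ | ⟨c, h⟩
  · have := h i; have := h (i + o); grind
  · have := h (i + o + o); have := h (i + o + o + o); grind
  · have b0 := h c; have b1 := h (c + o); have b2 := h i; have b3 := h (i + o)
    have b4 := hag c; have b5 := hag (c + o); have b6 := hN c; have b7 := hN (c + o)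
    have : c = i := by grind
    subst this; exact Or.inl h
  · have b0 := h c; have b1 := h (c + o); have b2 := h i; have b3 := h (i + o)
    have b4 := hag c; have b5 := hag (c + o); have b6 := hN c; have b7 := hN (c + o)
    have c0 := h (c - o); have c1 := hag (c - o); have c2 := hN (c - o)
    have : (c = i ∧ e = i - o) ∨ (c = i + o ∧ e = i + o + o) := by grind
    rcases this with ⟨rfl, he⟩ | ⟨rfl, he⟩
    · exact Or.inr (Or.inl ⟨he, h⟩)
    · exact Or.inr (Or.inr ⟨he, h⟩)

theorem step_arc3 {R : Type*} [CommRing R] {o : R} (hz : o ≠ 0 ∧ o + o ≠ 0 ∧ o + o + o ≠ 0 ∧ o + o + o + o ≠ 0)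
    {N N' : R → Prop} {e i : R} (hN : Arc3 o i N) (hN' : GoodN o N')
    (hag : ∀ j, j ≠ e → (N' j ↔ N j)) :
    Arc3 o i N' ∨ (e = i - o ∧ Arc2 o i N') ∨ (e = i + o ∧ Arc2 o (i - o) N') := by
  have n0 := hN (i - o); have n1 := hN i; have n2 := hN (i + o); have n3 := hN (i + o + o)
  have n4 := hN (i + o + o + o)
  have a0 := hag (i - o); have a1 := hag i; have a2 := hag (i + o); have a3 := hag (i + o + o)
  have a4 := hag (i + o + o + o)
  rcases good_cases hN' with h | h | ⟨c, h⟩ | ⟨c, h⟩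
  · have := h i; have := h (i + o); grind
  · have := h (i + o + o); have := h (i + o + o + o); grind
  · have b0 := h c; have b1 := h (c + o); have b2 := h i; have b3 := h (i + o)
    have c0 := h (i - o)
    have b4 := hag c; have b5 := hag (c + o); have b6 := hN c; have b7 := hN (c + o)
    have : (c = i ∧ e = i - o) ∨ (c = i - o ∧ e = i + o) := by grind
    rcases this with ⟨rfl, he⟩ | ⟨rfl, he⟩
    · exact Or.inr (Or.inl ⟨he, h⟩)
    · exact Or.inr (Or.inr ⟨he, h⟩)
  · have b0 := h c; have b1 := h (c + o); have b2 := h i; have b3 := h (i + o)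
    have b4 := hag c; have b5 := hag (c + o); have b6 := hN c; have b7 := hN (c + o)
    have c0 := h (c - o); have c1 := hag (c - o); have c2 := hN (c - o); have c3 := h (i - o)
    have : c = i := by grind
    subst this; exact Or.inl h

/-- two-step versions -/
theorem two_far {R : Type*} [CommRing R] {o : R} (hz : o ≠ 0 ∧ o + o ≠ 0 ∧ o + o + o ≠ 0 ∧ o + o + o + o ≠ 0)
    {N N1 N2 : R → Prop} {e i j : R} (hN : Arc2 o i N) (h1 : GoodN o N1) (h2 : GoodN o N2)
    (hag1 : ∀ k, k ≠ e → (N1 k ↔ N k)) (hag2 : ∀ k, k ≠ j → (N2 k ↔ N1 k))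
    (hj : j ≠ i - o ∧ j ≠ i ∧ j ≠ i + o ∧ j ≠ i + o + o) : ¬ N2 j := by
  rcases step_arc2 hz hN h1 hag1 with h | ⟨he, h⟩ | ⟨he, h⟩
  · rcases step_arc2 hz h h2 hag2 with g | ⟨ge, g⟩ | ⟨ge, g⟩
    · rw [g j]; grind
    · grind
    · grind
  · rcases step_arc3 hz h h2 hag2 with g | ⟨ge, g⟩ | ⟨ge, g⟩
    · rw [g j]; grind
    · grind
    · grind
  · rcases step_arc3 hz h h2 hag2 with g | ⟨ge, g⟩ | ⟨ge, g⟩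
    · rw [g j]; grind
    · grind
    · grind

theorem two_mid {R : Type*} [CommRing R] {o : R} (hz : o ≠ 0 ∧ o + o ≠ 0 ∧ o + o + o ≠ 0 ∧ o + o + o + o ≠ 0)
    {N N1 N2 : R → Prop} {e i j : R} (hN : Arc2 o i N) (h1 : GoodN o N1) (h2 : GoodN o N2)
    (hej : e = j - o ∨ e = j + o)
    (hag1 : ∀ k, k ≠ e → (N1 k ↔ N k)) (hag2 : ∀ k, k ≠ j → (N2 k ↔ N1 k))
    (hj : j = i ∨ j = i + o) : N2 j := by
  rcases step_arc2 hz hN h1 hag1 with h | ⟨he, h⟩ | ⟨he, h⟩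
  · rcases step_arc2 hz h h2 hag2 with g | ⟨ge, g⟩ | ⟨ge, g⟩
    · rw [g j]; grind
    · grind
    · grind
  · rcases step_arc3 hz h h2 hag2 with g | ⟨ge, g⟩ | ⟨ge, g⟩
    · rw [g j]; grind
    · grind
    · grind
  · rcases step_arc3 hz h h2 hag2 with g | ⟨ge, g⟩ | ⟨ge, g⟩
    · rw [g j]; grind
    · grind
    · grind

theorem two_left {R : Type*} [CommRing R] {o : R} (hz : o ≠ 0 ∧ o + o ≠ 0 ∧ o + o + o ≠ 0 ∧ o + o + o + o ≠ 0)
    {N N1 N2 : R → Prop} {e i j : R} (hN : Arc2 o i N) (h1 : GoodN o N1) (h2 : GoodN o N2)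
    (hej : e = j - o ∨ e = j + o)
    (hag1 : ∀ k, k ≠ e → (N1 k ↔ N k)) (hag2 : ∀ k, k ≠ j → (N2 k ↔ N1 k))
    (hj : j = i - o) (hjN : N2 j) : Arc3 o i N2 := by
  rcases step_arc2 hz hN h1 hag1 with h | ⟨he, h⟩ | ⟨he, h⟩
  · rcases step_arc2 hz h h2 hag2 with g | ⟨ge, g⟩ | ⟨ge, g⟩
    · rw [g j] at hjN; grind
    · exact g
    · grind
  · grind
  · grind

theorem two_right {R : Type*} [CommRing R] {o : R} (hz : o ≠ 0 ∧ o + o ≠ 0 ∧ o + o + o ≠ 0 ∧ o + o + o + o ≠ 0)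
    {N N1 N2 : R → Prop} {e i j : R} (hN : Arc3 o i N) (h1 : GoodN o N1) (h2 : GoodN o N2)
    (hej : e = j - o ∨ e = j + o)
    (hag1 : ∀ k, k ≠ e → (N1 k ↔ N k)) (hag2 : ∀ k, k ≠ j → (N2 k ↔ N1 k))
    (hj : j = i + o + o) : ¬ N2 j := by
  rcases step_arc3 hz hN h1 hag1 with h | ⟨he, h⟩ | ⟨he, h⟩
  · rcases step_arc3 hz h h2 hag2 with g | ⟨ge, g⟩ | ⟨ge, g⟩
    · rw [g j]; grind
    · grind
    · grind
  · grind
  · rcases step_arc2 hz h h2 hag2 with g | ⟨ge, g⟩ | ⟨ge, g⟩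
    · rw [g j]; grind
    · grind
    · grind

theorem znz' {n : ℕ} (hn : 5 ≤ n) : (1 : ZMod n) ≠ 0 ∧ (1 : ZMod n) + 1 ≠ 0 ∧ (1 : ZMod n) + 1 + 1 ≠ 0 ∧
    (1 : ZMod n) + 1 + 1 + 1 ≠ 0 := by
  obtain ⟨h1, h2, h3, h4⟩ := znz hn
  refine ⟨h1, ?_, ?_, ?_⟩
  · intro h; exact h2 (by linear_combination h)
  · intro h; exact h3 (by linear_combination h)
  · intro h; exact h4 (by linear_combination h)

theorem add_vertex {V : Type*} {G : SimpleGraph V} {n : ℕ} {B : ZMod n → Set V} (hB : IsBuoy G n B)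
    (x : V) (hx : ∀ j, x ∉ B j) (i : ZMod n) (hc : ∀ b ∈ B i, G.Adj x b)
    (hr : ∃ u ∈ B (i + 1), G.Adj x u) (hl : ∃ u ∈ B (i - 1), G.Adj x u)
    (hno : ∀ j, ∀ b ∈ B j, G.Adj x b → j = i ∨ j = i + 1 ∨ j = i - 1) :
    IsBuoy G n (fun j => {v | v ∈ B j ∨ (v = x ∧ j = i)}) := by
  obtain ⟨h5, hne, hcl, hdj, hn, hp, hnon⟩ := hB
  refine ⟨h5, ?_, ?_, ?_, ?_, ?_, ?_⟩
  · intro j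
    obtain ⟨v, hv⟩ := hne j
    exact ⟨v, Or.inl hv⟩
  · intro j u hu v hv huv
    rcases hu with hu | ⟨rfl, rfl⟩
    · rcases hv with hv | ⟨rfl, rfl⟩
      · exact hcl j hu hv huv
      · exact (hc u hu).symm
    · rcases hv with hv | ⟨rfl, _⟩
      · exact hc v hv
      · exact absurd rfl huv
  · intro j k hjk
    refine Set.disjoint_left.2 ?_
    rintro v (hv | ⟨rfl, rfl⟩) (hv' | ⟨hv', h'⟩)
    · exact Set.disjoint_left.1 (hdj hjk) hv hv'
    · subst hv'; exact hx _ hv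
    · exact hx _ hv'
    · exact hjk h'.symm
  · rintro j v (hv | ⟨rfl, rfl⟩)
    · obtain ⟨u, hu, h⟩ := hn j v hv
      exact ⟨u, Or.inl hu, h⟩
    · obtain ⟨u, hu, h⟩ := hr
      exact ⟨u, Or.inl hu, h⟩
  · rintro j v (hv | ⟨rfl, rfl⟩)
    · obtain ⟨u, hu, h⟩ := hp j v hv
      exact ⟨u, Or.inl hu, h⟩
    · obtain ⟨u, hu, h⟩ := hl
      exact ⟨u, Or.inl hu, h⟩
  · rintro j k h1 h2 h3 v (hv | ⟨rfl, rfl⟩) u (hu | ⟨rfl, rfl⟩) ha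
    · exact hnon j k h1 h2 h3 v hv u hu ha
    · rcases hno j v hv ha.symm with h | h | h
      · exact h1 h.symm
      · exact h3 (by linear_combination -h)
      · exact h2 (by linear_combination -h)
    · rcases hno k u hu ha with h | h | h
      · exact h1 h
      · exact h2 h
      · exact h3 h
    · exact h1 rfl

theorem maximal_add {V : Type*} {G : SimpleGraph V} {n : ℕ} {B : ZMod n → Set V} (hB : IsBuoy G n B)
    (hM : IsMaximalBuoy G (⋃ j, B j))
    (x : V) (hx : ∀ j, x ∉ B j) (i : ZMod n) (hc : ∀ b ∈ B i, G.Adj x b)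
    (hr : ∃ u ∈ B (i + 1), G.Adj x u) (hl : ∃ u ∈ B (i - 1), G.Adj x u)
    (hno : ∀ j, ∀ b ∈ B j, G.Adj x b → j = i ∨ j = i + 1 ∨ j = i - 1) : False := by
  have h := hM.2 _ ⟨n, _, add_vertex hB x hx i hc hr hl hno, rfl⟩ (by
    intro v hv
    rw [Set.mem_iUnion] at hv ⊢
    obtain ⟨j, hj⟩ := hv
    exact ⟨j, Or.inl hj⟩)
  have hxm : x ∈ ⋃ j, {v | v ∈ B j ∨ (v = x ∧ j = i)} := Set.mem_iUnion.2 ⟨i, Or.inr ⟨rfl, rfl⟩⟩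
  rw [h] at hxm
  obtain ⟨j, hj⟩ := Set.mem_iUnion.1 hxm
  exact hx j hj

def Type2 {V : Type*} (G : SimpleGraph V) {n : ℕ} (B : ZMod n → Set V) (i : ZMod n) (x : V) : Prop :=
  ∀ j, ∀ b ∈ B j, (G.Adj x b ↔ (j = i ∨ j = i + 1))

theorem classify {V : Type*} [Fintype V] {G : SimpleGraph V} (hE : ¬ HasEvenHole G) (hP : ¬ HasInducedPan G)
    {n : ℕ} {B : ZMod n → Set V} (hB : IsBuoy G n B)
    (hM : IsMaximalBuoy G (⋃ j, B j))
    (x : V) (hx : ∀ j, x ∉ B j) :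
    (∀ j, ∀ b ∈ B j, G.Adj x b) ∨ (∀ j, ∀ b ∈ B j, ¬ G.Adj x b) ∨ ∃ i, Type2 G B i x := by
  have hz := znz' hB.1
  have good : ∀ h, IsTransv G B h → GoodN 1 (fun j => G.Adj x (h j)) := by
    intro h hT
    exact hole_nbrs hE hP (hT.hole hB) x (by rintro ⟨j, rfl⟩; exact hx j (hT j).1)
  have ag : ∀ (h h' : ZMod n → V) (e : ZMod n), (∀ i, i ≠ e → h' i = h i) →
      ∀ j, j ≠ e → ((fun j => G.Adj x (h' j)) j ↔ (fun j => G.Adj x (h j)) j) := by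
    intro h h' e hh j hj
    simp only [hh j hj]
  by_cases hA2 : ∃ h i, IsTransv G B h ∧ Arc2 1 i (fun j => G.Adj x (h j))
  · obtain ⟨h, i, hT, hA⟩ := hA2
    have hmid : ∀ j, (j = i ∨ j = i + 1) → ∀ b ∈ B j, G.Adj x b := by
      intro j hj b hb
      obtain ⟨h1, h2, e, hT1, hT2, he, ag1, ag2, rfl⟩ := swap hE hP hB hT j b hb
      exact two_mid hz hA (good h1 hT1) (good h2 hT2) he (ag _ _ _ ag1) (ag _ _ _ ag2) hj
    have hfar : ∀ j, (j ≠ i - 1 ∧ j ≠ i ∧ j ≠ i + 1 ∧ j ≠ i + 1 + 1) → ∀ b ∈ B j, ¬ G.Adj x b := by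
      intro j hj b hb
      obtain ⟨h1, h2, e, hT1, hT2, he, ag1, ag2, rfl⟩ := swap hE hP hB hT j b hb
      exact two_far hz hA (good h1 hT1) (good h2 hT2) (ag _ _ _ ag1) (ag _ _ _ ag2) hj
    have hi1 : ∃ u ∈ B (i + 1), G.Adj x u := by
      obtain ⟨u, hu⟩ := hB.2.1 (i + 1)
      exact ⟨u, hu, hmid _ (Or.inr rfl) u hu⟩
    have hi0 : ∃ u ∈ B i, G.Adj x u := by
      obtain ⟨u, hu⟩ := hB.2.1 i
      exact ⟨u, hu, hmid _ (Or.inl rfl) u hu⟩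
    by_cases hL : ∃ b ∈ B (i - 1), G.Adj x b
    · exfalso
      have hL' := hL
      obtain ⟨b, hb, hxb⟩ := hL
      obtain ⟨h1, h2, e, hT1, hT2, he, ag1, ag2, rfl⟩ := swap hE hP hB hT (i - 1) b hb
      have hA3 := two_left hz hA (good h1 hT1) (good h2 hT2) he (ag _ _ _ ag1) (ag _ _ _ ag2) rfl hxb
      refine maximal_add hB hM x hx i (hmid i (Or.inl rfl)) hi1 hL' ?_
      intro j c hc hxc
      by_contra hcon
      push Not at hcon
      by_cases hj : j = i + 1 + 1
      · obtain ⟨g1, g2, e', gT1, gT2, ge, bg1, bg2, rfl⟩ := swap hE hP hB hT2 j c hc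
        exact two_right hz hA3 (good g1 gT1) (good g2 gT2) ge (ag _ _ _ bg1) (ag _ _ _ bg2) hj hxc
      · exact hfar j ⟨hcon.2.2, hcon.1, hcon.2.1, hj⟩ c hc hxc
    · push Not at hL
      by_cases hR : ∃ b ∈ B (i + 1 + 1), G.Adj x b
      · exfalso
        refine maximal_add hB hM x hx (i + 1) (hmid (i + 1) (Or.inr rfl)) hR ?_ ?_
        · rw [add_sub_cancel_right]; exact hi0
        intro j c hc hxc
        by_contra hcon
        push Not at hcon
        rw [add_sub_cancel_right] at hcon
        by_cases hj : j = i - 1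
        · subst hj; exact hL c hc hxc
        · exact hfar j ⟨hj, hcon.2.2, hcon.1, hcon.2.1⟩ c hc hxc
      · push Not at hR
        right; right
        refine ⟨i, fun j b hb => ⟨fun hxb => ?_, fun hj => hmid j hj b hb⟩⟩
        by_contra hcon
        push Not at hcon
        by_cases hj : j = i - 1
        · subst hj; exact hL b hb hxb
        by_cases hj' : j = i + 1 + 1
        · subst hj'; exact hR b hb hxb
        exact hfar j ⟨hj, hcon.1, hcon.2, hj'⟩ b hb hxb
  · push Not at hA2
    obtain ⟨h, hT⟩ := exists_trans hE hB
    rcases good_cases (good h hT) with hN | hN | ⟨i, hN⟩ | ⟨i, hN⟩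
    · right; left
      intro j b hb
      obtain ⟨h1, h2, e, hT1, hT2, he, ag1, ag2, rfl⟩ := swap hE hP hB hT j b hb
      exact step_empty hz (step_empty hz hN (good h1 hT1) (ag _ _ _ ag1)) (good h2 hT2) (ag _ _ _ ag2) j
    · left
      intro j b hb
      obtain ⟨h1, h2, e, hT1, hT2, he, ag1, ag2, rfl⟩ := swap hE hP hB hT j b hb
      exact step_univ hz (step_univ hz hN (good h1 hT1) (ag _ _ _ ag1)) (good h2 hT2) (ag _ _ _ ag2) j
    · exact absurd hN (hA2 h i hT)
    · exfalso
      have key : ∀ j, ∀ b ∈ B j, (G.Adj x b ↔ (j = i - 1 ∨ j = i ∨ j = i + 1)) := by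
        intro j b hb
        obtain ⟨h1, h2, e, hT1, hT2, he, ag1, ag2, rfl⟩ := swap hE hP hB hT j b hb
        have hN1 : Arc3 1 i (fun j => G.Adj x (h1 j)) := by
          rcases step_arc3 hz hN (good h1 hT1) (ag _ _ _ ag1) with g | ⟨-, g⟩ | ⟨-, g⟩
          · exact g
          · exact absurd g (hA2 h1 _ hT1)
          · exact absurd g (hA2 h1 _ hT1)
        rcases step_arc3 hz hN1 (good h2 hT2) (ag _ _ _ ag2) with g | ⟨-, g⟩ | ⟨-, g⟩
        · exact g j
        · exact absurd g (hA2 h2 _ hT2)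
        · exact absurd g (hA2 h2 _ hT2)
      refine maximal_add hB hM x hx i (fun b hb => (key i b hb).2 (by simp)) ?_ ?_ ?_
      · obtain ⟨u, hu⟩ := hB.2.1 (i + 1)
        exact ⟨u, hu, (key _ u hu).2 (by simp)⟩
      · obtain ⟨u, hu⟩ := hB.2.1 (i - 1)
        exact ⟨u, hu, (key _ u hu).2 (by simp)⟩
      · intro j b hb hxb
        have := (key j b hb).1 hxb
        tauto

theorem type2_clique {V : Type*} [Fintype V] {G : SimpleGraph V} (hE : ¬ HasEvenHole G) (hP : ¬ HasInducedPan G)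
    {n : ℕ} {B : ZMod n → Set V} (hB : IsBuoy G n B)
    (x : V) (hx : ∀ j, x ∉ B j) (i : ZMod n) (h2 : Type2 G B i x) (b c : V) (hb : b ∈ B i)
    (hc : c ∈ B (i + 1)) : G.Adj b c := by
  by_contra hbc
  have hz := znz hB.1
  obtain ⟨h0, hT0⟩ := exists_trans hE hB
  obtain ⟨-, h, e, -, hT, -, -, -, rfl⟩ := swap hE hP hB hT0 i b hb
  have e1 : i + 1 - 1 = i := by ring
  have e2 : i + 1 + 1 = i + 2 := by ring
  have hca : G.Adj c (h (i + 2)) := by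
    have := bag_adj hP hB hT (i + 1) c hc
    rw [e1, e2] at this
    rcases this with h | h
    · exact absurd h.symm hbc
    · exact h
  refine even_ext hE (hT.hole hB) i x c ((h2 _ c hc).2 (Or.inr rfl)) ((h2 _ _ hb).2 (Or.inl rfl)) hca
    ?_ ?_ ?_ ?_
  · intro t ht
    exact (h2 t _ (hT t).1).1 ht
  · intro t ht
    rcases hB.adj_idx hc (hT t).1 ht with h' | h' | h'
    · exact Or.inr h'
    · left; rw [h', e2]
    · exfalso
      rw [e1] at h'
      subst h'
      exact hbc ht.symm
  · rintro t rfl; exact hx t (hT t).1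
  · rintro t rfl
    have := hB.bag_eq hc (hT t).1
    subst this
    exact hbc (hT i).2

theorem complete_clique {V : Type*} [Fintype V] {G : SimpleGraph V} (hE : ¬ HasEvenHole G)
    {n : ℕ} {B : ZMod n → Set V} (hB : IsBuoy G n B) (x y : V) (hxy : x ≠ y)
    (hx : ∀ j, ∀ b ∈ B j, G.Adj x b) (hy : ∀ j, ∀ b ∈ B j, G.Adj y b) : G.Adj x y := by
  by_contra hcon
  have hz := znz hB.1
  obtain ⟨u, hu⟩ := hB.2.1 0
  obtain ⟨v, hv⟩ := hB.2.1 2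
  refine noC4 hE x u y v (hx _ u hu) (hy _ u hu).symm (hy _ v hv) (hx _ v hv).symm hxy ?_ hcon ?_
  · rintro rfl
    exact hz.2.1 (hB.bag_eq hu hv).symm
  · intro ha
    rcases hB.adj_idx hu hv ha with h | h | h
    · exact hz.2.1 h
    · exact hz.1 (by linear_combination h)
    · exact hz.2.2.1 (by linear_combination h)

theorem half_arc {V : Type*} {G : SimpleGraph V} (hE : ¬ HasEvenHole G)
    {n : ℕ} {B : ZMod n → Set V} (hB : IsBuoy G n B) {h : ZMod n → V} (hT : IsTransv G B h)
    (i j : ZMod n) (hij : i ≠ j) (k : ℕ) (hk : 1 ≤ k) (p : ℕ → V) (hp : IndPath G k p)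
    (h0 : Type2 G B j (p 0)) (hk2 : Type2 G B i (p k))
    (hin : ∀ t, 0 < t → t < k → ∀ j, ∀ b ∈ B j, ¬ G.Adj (p t) b)
    (hX : ∀ t, t ≤ k → ∀ j, p t ∉ B j) : ¬ Even ((j - i).val - 1 + k) := by
  have h5 := hB.1
  haveI : NeZero n := ⟨by omega⟩
  intro hev
  obtain ⟨d, hd⟩ : ∃ d, d = (j - i).val := ⟨_, rfl⟩
  rw [← hd] at hev
  have hdn : d < n := hd ▸ ZMod.val_lt _
  have hd0 : d ≠ 0 := by
    rw [hd]
    intro h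
    rw [ZMod.val_eq_zero] at h
    exact hij (sub_eq_zero.1 h).symm
  have hj : j = i + (d : ℕ) := by
    rw [hd, ZMod.natCast_zmod_val]; ring
  have hlen : 4 ≤ (d - 1) + k + 2 := by
    obtain ⟨c, hc⟩ := hev
    omega
  refine glue_even hE hlen (arc_path (hT.hole hB) (i + 1) (d - 1) (by omega)) hp ?_ hev
  intro a b ha hb
  refine ⟨fun he => hX b hb _ (he ▸ (hT _).1), ?_⟩
  rw [G.adj_comm]
  by_cases hb0 : b = 0
  · subst hb0
    rw [h0 _ _ (hT _).1]
    have e1 : (i + 1 + (a : ZMod n) = j) ↔ a = d - 1 := by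
      rw [hj, add_assoc, add_right_inj]
      have : (1 : ZMod n) + a = ((a + 1 : ℕ) : ZMod n) := by push_cast; ring
      rw [this, zcast (by omega) hdn]
      omega
    have e2 : ¬ (i + 1 + (a : ZMod n) = j + 1) := by
      intro h
      have : (a : ZMod n) = (d : ZMod n) := by rw [hj] at h; linear_combination h
      rw [zcast (by omega) hdn] at this
      omega
    rw [e1]
    constructor
    · rintro (h | h)
      · exact Or.inl ⟨h, rfl⟩
      · exact absurd h e2
    · rintro (h | h)
      · exact Or.inl h.1
      · omega
  by_cases hbk : b = k
  · subst hbk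
    rw [hk2 _ _ (hT _).1]
    have e1 : ¬ (i + 1 + (a : ZMod n) = i) := by
      intro h
      have : ((a + 1 : ℕ) : ZMod n) = ((0 : ℕ) : ZMod n) := by push_cast; linear_combination h
      rw [zcast (by omega) (by omega)] at this
      omega
    have e2 : (i + 1 + (a : ZMod n) = i + 1) ↔ a = 0 := by
      have : (i + 1 + (a : ZMod n) = i + 1) ↔ (a : ZMod n) = ((0 : ℕ) : ZMod n) := by simp
      rw [this, zcast (by omega) (by omega)]
    rw [e2]
    constructor
    · rintro (h | h)
      · exact absurd h e1
      · exact Or.inr ⟨h, rfl⟩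
    · rintro (h | h)
      · omega
      · exact Or.inr h.1
  · have := hin b (by omega) (by omega) _ _ (hT (i + 1 + (a : ZMod n))).1
    constructor
    · intro h; exact absurd h this
    · intro h; omega

theorem no_ind_path {V : Type*} {G : SimpleGraph V} (hE : ¬ HasEvenHole G)
    {n : ℕ} {B : ZMod n → Set V} (hB : IsBuoy G n B) {h : ZMod n → V} (hT : IsTransv G B h)
    (i j : ZMod n) (hij : i ≠ j) (k : ℕ) (hk : 1 ≤ k) (p : ℕ → V) (hp : IndPath G k p)
    (h0 : Type2 G B j (p 0)) (hk2 : Type2 G B i (p k))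
    (hin : ∀ t, 0 < t → t < k → ∀ j, ∀ b ∈ B j, ¬ G.Adj (p t) b)
    (hX : ∀ t, t ≤ k → ∀ j, p t ∉ B j) : False := by
  have h5 := hB.1
  haveI : NeZero n := ⟨by omega⟩
  have hodd : ¬ Even n := fun hev => hE ⟨n, h, hT.hole hB, hev⟩
  have a1 := half_arc hE hB hT i j hij k hk p hp h0 hk2 hin hX
  have a2 := half_arc hE hB hT j i hij.symm k hk _ hp.rev (by simpa using hk2) (by simpa using h0)
    (fun t h1 h2 => hin (k - t) (by omega) (by omega)) (fun t h1 => hX (k - t) (by omega))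
  have hne : j - i ≠ 0 := sub_ne_zero.2 hij.symm
  have e : (i - j).val = n - (j - i).val := by
    rw [← neg_sub, ZMod.neg_val, if_neg hne]
  have hlt := ZMod.val_lt (j - i)
  have hpos : (j - i).val ≠ 0 := by rwa [Ne, ZMod.val_eq_zero]
  rw [e] at a2
  rw [Nat.even_iff] at a1 a2 hodd
  omega

/-- connecting sequence of length `n` inside `R` between vertices of different types -/
def Conn {V : Type*} (G : SimpleGraph V) {m : ℕ} (B : ZMod m → Set V) (R : Set V) (n : ℕ) (p : ℕ → V) :
    Prop :=
  (∃ i j, i ≠ j ∧ Type2 G B j (p 0) ∧ Type2 G B i (p n)) ∧ (∀ t, t ≤ n → p t ∈ R) ∧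
    ∀ t, t < n → G.Adj (p t) (p (t + 1))

theorem no_conn {V : Type*} {G : SimpleGraph V} (hE : ¬ HasEvenHole G)
    {m : ℕ} {B : ZMod m → Set V} (hB : IsBuoy G m B) {h : ZMod m → V} (hT : IsTransv G B h)
    (R : Set V) (hR : ∀ v ∈ R, (∀ j, v ∉ B j) ∧ ((∀ j, ∀ b ∈ B j, ¬ G.Adj v b) ∨ ∃ i, Type2 G B i v))
    (n : ℕ) (p : ℕ → V) (hp : Conn G B R n p) : False := by
  classical
  have hex : ∃ n, ∃ p, Conn G B R n p := ⟨n, p, hp⟩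
  clear hp p n
  obtain ⟨p, ⟨i, j, hij, h0, hn⟩, hpR, hadj⟩ := Nat.find_spec hex
  have hmin : ∀ k, k < Nat.find hex → ∀ p, ¬ Conn G B R k p := by
    intro k hk p hp
    exact Nat.find_min hex hk ⟨p, hp⟩
  generalize Nat.find hex = n at *
  have hz := znz hB.1
  have huniq : ∀ v i j, Type2 G B i v → Type2 G B j v → i = j := by
    intro v i j hi hj
    have a1 := (hj i (h i) (hT i).1).1 ((hi i (h i) (hT i).1).2 (Or.inl rfl))
    have a2 := (hj (i + 1) (h (i + 1)) (hT _).1).1 ((hi _ _ (hT _).1).2 (Or.inr rfl))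
    rcases a1 with a1 | a1
    · exact a1
    · exfalso
      rcases a2 with a2 | a2
      · exact hz.2.1 (by linear_combination a2 - a1)
      · exact hz.1 (by linear_combination a2 - a1)
  have hn1 : 1 ≤ n := by
    by_contra hcon
    have : n = 0 := by omega
    subst this
    exact hij (huniq _ _ _ hn h0)
  have hin : ∀ t, 0 < t → t < n → ∀ j, ∀ b ∈ B j, ¬ G.Adj (p t) b := by
    intro t ht0 htn
    rcases (hR _ (hpR t htn.le)).2 with h' | ⟨k, hk⟩
    · exact h'
    · exfalso
      by_cases hkj : k = j
      · refine hmin (n - t) (by omega) (fun s => p (t + s)) ⟨⟨i, k, ?_, by simpa using hk, ?_⟩, ?_, ?_⟩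
        · rw [hkj]; exact hij
        · have : t + (n - t) = n := by omega
          simpa [this] using hn
        · intro s hs; exact hpR _ (by omega)
        · intro s hs; exact hadj (t + s) (by omega)
      · exact hmin t htn p ⟨⟨k, j, hkj, h0, hk⟩, fun s hs => hpR s (by omega),
          fun s hs => hadj s (by omega)⟩
  have hind : IndPath G n p := by
    intro a b hab hb
    constructor
    · intro heq
      refine hmin (n - (b - a)) (by omega) (fun s => if s < a then p s else p (s + (b - a)))
        ⟨⟨i, j, hij, ?_, ?_⟩, ?_, ?_⟩
      · by_cases ha : 0 < a
        · simpa [ha] using h0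
        · have ha0 : a = 0 := by omega
          subst ha0
          simpa [← heq] using h0
      · have e1 : ¬ (n - (b - a) < a) := by omega
        have e2 : n - (b - a) + (b - a) = n := by omega
        simpa [e1, e2] using hn
      · intro s hs
        dsimp only
        split_ifs
        · exact hpR _ (by omega)
        · exact hpR _ (by omega)
      · intro s hs
        dsimp only
        by_cases h1 : s + 1 < a
        · rw [if_pos (by omega), if_pos h1]
          exact hadj s (by omega)
        · by_cases h2 : s < a
          · rw [if_pos h2, if_neg h1]
            have e1 : s + 1 = a := by omega
            have e2 : s + 1 + (b - a) = b := by omega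
            rw [e2, ← heq, ← e1]
            exact hadj s (by omega)
          · rw [if_neg h2, if_neg h1]
            have := hadj (s + (b - a)) (by omega)
            have e2 : s + 1 + (b - a) = s + (b - a) + 1 := by omega
            rw [e2]; exact this
    · constructor
      · intro ha
        by_contra hne
        refine hmin (n - (b - a - 1)) (by omega) (fun s => if s ≤ a then p s else p (s + (b - a - 1)))
          ⟨⟨i, j, hij, ?_, ?_⟩, ?_, ?_⟩
        · simpa using h0
        · have e1 : ¬ (n - (b - a - 1) ≤ a) := by omega
          have e2 : n - (b - a - 1) + (b - a - 1) = n := by omega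
          simpa only [e1, e2, if_false] using hn
        · intro s hs
          dsimp only
          split_ifs
          · exact hpR _ (by omega)
          · exact hpR _ (by omega)
        · intro s hs
          dsimp only
          by_cases h1 : s + 1 ≤ a
          · rw [if_pos (by omega), if_pos h1]
            exact hadj s (by omega)
          · by_cases h2 : s ≤ a
            · rw [if_pos h2, if_neg h1]
              have e1 : s = a := by omega
              have e2 : s + 1 + (b - a - 1) = b := by omega
              rw [e2, e1]
              exact ha
            · rw [if_neg h2, if_neg h1]
              have := hadj (s + (b - a - 1)) (by omega)
              have e2 : s + 1 + (b - a - 1) = s + (b - a - 1) + 1 := by omega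
              rw [e2]; exact this
      · rintro rfl
        exact hadj a (by omega)
  exact no_ind_path hE hB hT i j hij n hn1 p hind h0 hn hin (fun t ht => (hR _ (hpR t ht)).1)

theorem cut_of {V : Type*} {G : SimpleGraph V} (hconn : G.Connected)
    {m : ℕ} {B : ZMod m → Set V} (hB : IsBuoy G m B)
    (R : Set V) (hR : R = {v | (∀ j, v ∉ B j) ∧ ¬ ∀ j, ∀ b ∈ B j, G.Adj v b})
    (r : R) (J : Set (ZMod m)) (j0 : ZMod m) (hj0 : j0 ∉ J)
    (hJ : ∀ q : R, (G.induce R).Reachable r q → ∀ j, ∀ b ∈ B j, G.Adj q b → j ∈ J)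
    (hS : G.IsClique {v | (∀ j, ∀ b ∈ B j, G.Adj v b) ∨ ∃ j ∈ J, v ∈ B j}) :
    ∃ S, IsCliqueCutset G S := by
  obtain ⟨S, hSd⟩ : ∃ S : Set V, S = {v | (∀ j, ∀ b ∈ B j, G.Adj v b) ∨ ∃ j ∈ J, v ∈ B j} := ⟨_, rfl⟩
  rw [← hSd] at hS
  obtain ⟨w, hw⟩ := hB.2.1 j0
  have hrR : (∀ j, (r : V) ∉ B j) ∧ ¬ ∀ j, ∀ b ∈ B j, G.Adj r b := by
    exact (Set.ext_iff.1 hR r).1 r.2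
  have hr : (r : V) ∈ Sᶜ := by
    rw [hSd]
    rintro (h | ⟨j, -, h⟩)
    · exact hrR.2 h
    · exact hrR.1 j h
  have hwS : w ∈ Sᶜ := by
    rw [hSd]
    rintro (h | ⟨j, hj, h⟩)
    · exact G.irrefl (h _ w hw)
    · rw [hB.bag_eq hw h] at hj0
      exact hj0 hj
  refine ⟨S, hS, ⟨r, hr⟩, ⟨w, hwS⟩, hconn.preconnected _ _, ?_⟩
  intro hreach
  rw [SimpleGraph.reachable_iff_reflTransGen] at hreach
  have key : ∀ z : ↥(Sᶜ), Relation.ReflTransGen (G.induce Sᶜ).Adj ⟨r, hr⟩ z →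
      ∃ hz : (z : V) ∈ R, (G.induce R).Reachable r ⟨z, hz⟩ := by
    intro z hz
    induction hz with
    | refl => exact ⟨r.2, SimpleGraph.Reachable.refl _⟩
    | @tail y z _ hyz ih =>
      obtain ⟨hy, hry⟩ := ih
      have hadj : G.Adj (y : V) (z : V) := hyz
      have hzS : ¬ ((∀ j, ∀ b ∈ B j, G.Adj (z : V) b) ∨ ∃ j ∈ J, (z : V) ∈ B j) := by
        exact fun h' => z.2 ((Set.ext_iff.1 hSd z).2 h')
      have hzR : (z : V) ∈ R := by
        rw [hR]
        refine ⟨fun j hj => hzS (Or.inr ⟨j, hJ ⟨y, hy⟩ hry j z hj hadj, hj⟩), fun h => hzS (Or.inl h)⟩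
      refine ⟨hzR, hry.trans (SimpleGraph.Adj.reachable ?_)⟩
      exact hadj
  obtain ⟨hz, -⟩ := key _ hreach
  rw [hR] at hz
  exact hz.1 j0 hw

theorem main_core {V : Type*} [Fintype V] {G : SimpleGraph V} (hconn : G.Connected)
    (hE : ¬ HasEvenHole G) (hP : ¬ HasInducedPan G) (hnc : ¬ ∃ S, IsCliqueCutset G S)
    {m : ℕ} {B : ZMod m → Set V} (hB : IsBuoy G m B) (hM : IsMaximalBuoy G (⋃ j, B j)) (v : V)
    (hv : ∀ j, v ∉ B j) : ∀ j, ∀ b ∈ B j, G.Adj v b := by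
  by_contra hcon
  obtain ⟨R, hR⟩ : ∃ R : Set V, R = {v | (∀ j, v ∉ B j) ∧ ¬ ∀ j, ∀ b ∈ B j, G.Adj v b} := ⟨_, rfl⟩
  have hvR : v ∈ R := by rw [hR]; exact ⟨hv, hcon⟩
  have hz := znz hB.1
  obtain ⟨h, hT⟩ := exists_trans hE hB
  have hcl : ∀ v ∈ R, (∀ j, v ∉ B j) ∧ ((∀ j, ∀ b ∈ B j, ¬ G.Adj v b) ∨ ∃ i, Type2 G B i v) := by
    intro v hv
    rw [hR] at hv
    refine ⟨hv.1, ?_⟩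
    rcases classify hE hP hB hM v hv.1 with h' | h'
    · exact absurd h' hv.2
    · exact h'
  by_cases hex : ∃ q : R, (G.induce R).Reachable ⟨v, hvR⟩ q ∧ ∃ i, Type2 G B i q
  · obtain ⟨q, hq, i, hqi⟩ := hex
    refine hnc (cut_of hconn hB R hR ⟨v, hvR⟩ {i, i + 1} (i + 2) ?_ ?_ ?_)
    · rintro (h' | h')
      · exact hz.2.1 (by linear_combination h')
      · have h'' : i + 2 = i + 1 := h'
        exact hz.1 (by linear_combination h'')
    · intro q' hq' j b hb hab
      rcases (hcl q' q'.2).2 with h' | ⟨i', hi'⟩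
      · exact absurd hab (h' j b hb)
      · have hii : i' = i := by
          by_contra hne
          obtain ⟨w⟩ := hq.symm.trans hq'
          refine no_conn hE hB hT R hcl w.length (fun t => (w.getVert t : V))
            ⟨⟨i', i, hne, ?_, ?_⟩, fun t _ => (w.getVert t).2, fun t ht => w.adj_getVert_succ ht⟩
          · simpa using hqi
          · simpa using hi'
        subst hii
        exact (hi' j b hb).1 hab
    · have hqX := (hcl q q.2).1
      have hbc := type2_clique hE hP hB q hqX i hqi
      rintro x (hx | ⟨j, hj, hx⟩) y (hy | ⟨k, hk, hy⟩) hxy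
      · exact complete_clique hE hB x y hxy hx hy
      · exact hx k y hy
      · exact (hy j x hx).symm
      · rcases hj with rfl | rfl <;> rcases hk with rfl | rfl
        · exact hB.2.2.1 _ hx hy hxy
        · exact hbc x y hx hy
        · exact (hbc y x hy hx).symm
        · exact hB.2.2.1 _ hx hy hxy
  · refine hnc (cut_of hconn hB R hR ⟨v, hvR⟩ ∅ 0 (by simp) ?_ ?_)
    · intro q hq j b hb hab
      exfalso
      rcases (hcl q q.2).2 with h' | h'
      · exact h' j b hb hab
      · exact hex ⟨q, hq, h'⟩
    · rintro x (hx | ⟨j, hj, hx⟩) y (hy | ⟨k, hk, hy⟩) hxy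
      · exact complete_clique hE hB x y hxy hx hy
      · exact absurd hk (by simp)
      · exact absurd hj (by simp)
      · exact absurd hj (by simp)

theorem stmt_15 {V : Type*} [Fintype V] (G : SimpleGraph V) (hconn : G.Connected)
    (hatoms : ∀ A : Set V, IsGraphAtom G A →
      ¬ HasInducedPan (G.induce A) ∧ ¬ HasEvenHole (G.induce A)) :
    G.IsClique Set.univ ∨
    (∃ S : Set V, IsCliqueCutset G S) ∨
    (∀ X : Set V, IsMaximalBuoy G X →
      X = Set.univ ∨
      ∃ K : Set V, K.Nonempty ∧ G.IsClique K ∧ Disjoint X K ∧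
        X ∪ K = Set.univ ∧ ∀ x ∈ X, ∀ k ∈ K, G.Adj x k) := by
  right
  by_cases hnc : ∃ S : Set V, IsCliqueCutset G S
  · exact Or.inl hnc
  right
  have hatom : IsGraphAtom G Set.univ := by
    refine ⟨(SimpleGraph.induceUnivIso G).connected_iff.2 hconn, ?_⟩
    rintro S ⟨hS, u, v, huv, hnr⟩
    have hmem : ∀ w : ↥(Sᶜ), ((w : ↥(Set.univ : Set V)) : V) ∈ (Subtype.val '' S)ᶜ := by
      rintro w ⟨z, hz, hzw⟩
      exact w.2 (Subtype.ext hzw ▸ hz)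
    have hmem2 : ∀ w : ↥((Subtype.val '' S : Set V)ᶜ), (⟨w, trivial⟩ : ↥(Set.univ : Set V)) ∈ Sᶜ := by
      intro w hw
      exact w.2 ⟨_, hw, rfl⟩
    refine hnc ⟨Subtype.val '' S, ?_, ⟨u, hmem u⟩, ⟨v, hmem v⟩, hconn.preconnected _ _, ?_⟩
    · rintro _ ⟨x, hx, rfl⟩ _ ⟨y, hy, rfl⟩ hxy
      exact hS hx hy (fun h => hxy (congrArg _ h))
    · intro hr
      apply hnr
      let F : G.induce (Subtype.val '' S : Set V)ᶜ →g (G.induce (Set.univ : Set V)).induce Sᶜ :=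
        { toFun := fun w => ⟨⟨w, trivial⟩, hmem2 w⟩
          map_rel' := fun h => h }
      exact hr.map F
  obtain ⟨hP', hE'⟩ := hatoms _ hatom
  have hhole : ∀ n (f : ZMod n → V), IsHole G n f →
      IsHole (G.induce (Set.univ : Set V)) n (fun i => ⟨f i, trivial⟩) := by
    rintro n f ⟨h4, hinj, hadj⟩
    exact ⟨h4, fun a b hab => hinj (congrArg Subtype.val hab), fun a b => hadj a b⟩
  have hE : ¬ HasEvenHole G := by
    rintro ⟨n, f, hf, hev⟩
    exact hE' ⟨n, _, hhole n f hf, hev⟩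
  have hP : ¬ HasInducedPan G := by
    rintro ⟨n, f, x, hf, hx, hu⟩
    refine hP' ⟨n, _, ⟨x, trivial⟩, hhole n f hf, ?_, hu⟩
    rintro ⟨i, hi⟩
    exact hx ⟨i, congrArg Subtype.val hi⟩
  intro X hM
  obtain ⟨⟨m, B, hB, rfl⟩, -⟩ := id hM
  have key := main_core hconn hE hP hnc hB hM
  by_cases hX : (⋃ j, B j) = Set.univ
  · exact Or.inl hX
  right
  have hout : ∀ v, v ∈ (⋃ j, B j)ᶜ → ∀ j, v ∉ B j := by
    intro v hv j hj
    exact hv (Set.mem_iUnion.2 ⟨j, hj⟩)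
  refine ⟨(⋃ j, B j)ᶜ, Set.nonempty_compl.2 hX, ?_, disjoint_compl_right, Set.union_compl_self _, ?_⟩
  · intro x hx y hy hxy
    exact complete_clique hE hB x y hxy (key x (hout x hx)) (key y (hout y hy))
  · intro x hx k hk
    obtain ⟨j, hj⟩ := Set.mem_iUnion.1 hx
    exact (key k (hout k hk) j x hj).symm
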